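/- For every positive integer $n$, the quantity $S_n = \dfrac{\binom{6n}{3n}\binom{3n}{n}}{2(2n+1)\binom{2n}{n}}$ satisfies $3S_n \equiv 0 \pmod{2n+3}$; equivalently, $2(2n+1)(2n+3)\binom{2n}{n}$ divides $3\binom{6n}{3n}\binom{3n}{n}$. -/

import Mathlib

/-- The integer `4 ^ k * (m + k - 1/2).choose k`, given by Pascal's rule. -/
def halfChoose : ℕ → ℕ → ℕ
  | 0, k => Nat.centralBinom k
  | _ + 1, 0 => 1
  | m + 1, k + 1 => halfChoose m (k + 1) + 4 * halfChoose (m + 1) k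

theorem halfChoose_zero_right (m : ℕ) : halfChoose m 0 = 1 := by
  cases m <;> simp [halfChoose]

theorem two_dvd_halfChoose_succ (m k : ℕ) : 2 ∣ halfChoose m (k + 1) := by
  induction m with
  | zero => simpa [halfChoose] using Nat.two_dvd_centralBinom_succ k
  | succ m ih =>
    rw [halfChoose]
    omega

theorem succ_mul_halfChoose_succ (m k : ℕ) :
    (k + 1) * halfChoose m (k + 1) = 2 * (2 * (m + k) + 1) * halfChoose m k := by
  induction m generalizing k with
  | zero => simpa [halfChoose] using Nat.succ_mul_centralBinom_succ k
  | succ m ihm =>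
    induction k with
    | zero =>
      have h := ihm 0
      simp only [halfChoose, halfChoose_zero_right] at h ⊢
      linarith
    | succ k ihk =>
      have h := ihm (k + 1)
      have hp : halfChoose (m + 1) (k + 1) =
          halfChoose m (k + 1) + 4 * halfChoose (m + 1) k := by rw [halfChoose]
      have hp' : halfChoose (m + 1) (k + 1 + 1) =
          halfChoose m (k + 1 + 1) + 4 * halfChoose (m + 1) (k + 1) := by rw [halfChoose]
      zify at *
      linear_combination h + ((k : ℤ) + 2) * hp' - 2 * (2 * m + 2 * k + 3) * hp + 4 * ihk

theorem halfChoose_mul_centralBinom (m k : ℕ) :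
    halfChoose m k * m.centralBinom = (m + k).centralBinom * (m + k).choose k := by
  induction k with
  | zero => simp [halfChoose_zero_right]
  | succ k ih =>
    have h := succ_mul_halfChoose_succ m k
    have hc := Nat.succ_mul_centralBinom_succ (m + k)
    have hb := Nat.add_one_mul_choose_eq (m + k) k
    refine Nat.eq_of_mul_eq_mul_left k.succ_pos ?_
    rw [← add_assoc]
    zify at *
    linear_combination (m.centralBinom : ℤ) * h + 2 * (2 * ((m : ℤ) + k) + 1) * ih -
      ((m + k).choose k : ℤ) * hc + ((m + k + 1).centralBinom : ℤ) * hb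

theorem two_mul_add_one_dvd_halfChoose (n : ℕ) : 2 * n + 1 ∣ halfChoose n (2 * n) := by
  have h := succ_mul_halfChoose_succ n (2 * n)
  have hcop : IsCoprime (2 * n + 1 : ℤ) (2 * (2 * (n + 2 * n) + 1)) :=
    IsCoprime.mul_right ⟨1, -n, by ring⟩ ⟨1 - 3 * n, n, by ring⟩
  have hd : (2 * n + 1 : ℤ) ∣ 2 * (2 * (n + 2 * n) + 1) * halfChoose n (2 * n) :=
    ⟨halfChoose n (2 * n + 1), by exact_mod_cast h.symm⟩
  exact_mod_cast hcop.dvd_of_dvd_mul_left hd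

theorem two_mul_add_three_dvd_three_mul_halfChoose (n : ℕ) :
    2 * n + 3 ∣ 3 * halfChoose n (2 * n) := by
  have h₀ := succ_mul_halfChoose_succ n (2 * n)
  have h₁ := succ_mul_halfChoose_succ n (2 * n + 1)
  have h₂ := succ_mul_halfChoose_succ n (2 * n + 2)
  have hd : (2 * n + 3 : ℤ) ∣ (2 : ℤ) ^ 3 * ((6 * n + 1) * ((2 * n + 1) * (6 * n + 5))) *
      ((3 * halfChoose n (2 * n) : ℕ) : ℤ) := by
    refine ⟨(2 * n + 2) * (2 * n + 1) * halfChoose n (2 * n + 3), ?_⟩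
    push_cast
    zify at h₀ h₁ h₂
    linear_combination -((2 * n + 2) * (2 * n + 1) : ℤ) * h₂ -
      2 * (6 * n + 5) * (2 * n + 1) * h₁ - 4 * (6 * n + 5) * (6 * n + 3) * h₀
  have two : IsCoprime (2 * n + 3 : ℤ) 2 := ⟨1, -(n + 1), by ring⟩
  have hcop : IsCoprime (2 * n + 3 : ℤ) (2 ^ 3 * ((6 * n + 1) * ((2 * n + 1) * (6 * n + 5)))) := by
    refine two.pow_right.mul_right (.mul_right ?_ (.mul_right ?_ ?_))
    · have h : IsCoprime (2 * n + 3 : ℤ) (-(2 ^ 3) + (2 * n + 3) * 3) :=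
        two.pow_right.neg_right.add_mul_left_right 3
      convert h using 1
      ring
    · have h : IsCoprime (2 * n + 3 : ℤ) (-2 + (2 * n + 3) * 1) :=
        two.neg_right.add_mul_left_right 1
      convert h using 1
      ring
    · have h : IsCoprime (2 * n + 3 : ℤ) (-(2 ^ 2) + (2 * n + 3) * 3) :=
        two.pow_right.neg_right.add_mul_left_right 3
      convert h using 1
      ring
  exact_mod_cast hcop.dvd_of_dvd_mul_left hd

theorem theorem_A (n : ℕ) (hn : 0 < n) :
    2 * (2 * n + 1) * (2 * n + 3) * Nat.choose (2 * n) n ∣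
      3 * (Nat.choose (6 * n) (3 * n) * Nat.choose (3 * n) n) := by
  have key := halfChoose_mul_centralBinom n (2 * n)
  rw [show n + 2 * n = 3 * n by ring, Nat.centralBinom, Nat.centralBinom,
    show 2 * (3 * n) = 6 * n by ring,
    Nat.choose_symm_of_eq_add (show 3 * n = 2 * n + n by ring)] at key
  rw [← key, ← mul_assoc]
  refine mul_dvd_mul_right ?_ _
  have heven : 2 ∣ 3 * halfChoose n (2 * n) := by
    obtain ⟨k, hk⟩ : ∃ k, 2 * n = k + 1 := ⟨2 * n - 1, by omega⟩
    rw [hk]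
    exact (two_dvd_halfChoose_succ n k).mul_left 3
  have hodd (k : ℕ) : Nat.Coprime 2 (2 * k + 1) := by simp
  have hcop : Nat.Coprime (2 * n + 1) (2 * n + 3) := by
    rw [show 2 * n + 3 = 2 + (2 * n + 1) by ring, Nat.coprime_add_self_right]
    exact (hodd n).symm
  refine Nat.Coprime.mul_dvd_of_dvd_of_dvd (.mul_left (hodd (n + 1)) hcop) ?_
    (two_mul_add_three_dvd_three_mul_halfChoose n)
  exact (hodd n).mul_dvd_of_dvd_of_dvd heven ((two_mul_add_one_dvd_halfChoose n).mul_left 3)
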